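/- Let X : Ω → ℝ be an integrable random variable on a probability space and suppose C ≥ 0 is such that |E[f'(X)] − E[X·f(X)]| ≤ C for every twice differentiable function f : ℝ → ℝ satisfying ‖f‖_∞ ≤ 2, ‖f'‖_∞ ≤ √(2/π), and ‖f''‖_∞ ≤ 2. Then for every Lipschitz function h : ℝ → ℝ with Lip(h) ≤ 1 one has |E[h(X)] − ∫_ℝ h dγ| ≤ C; that is, d_Wass(X, N(0,1)) ≤ sup of |E[f'(X) − X f(X)]| over the above class of functions f. -/

import Mathlib

open MeasureTheory ProbabilityTheory

namespace SteinAux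
open Set Filter Topology

lemma hd_congr {f g : ℝ → ℝ} {f' g' x : ℝ} (h : HasDerivAt f f' x) (e : ∀ y, g y = f y)
    (e' : g' = f') : HasDerivAt g g' x := by
  have : g = f := funext e
  rw [this, e']; exact h

/-- standard normal density -/
noncomputable def ph (x : ℝ) : ℝ := gaussianPDFReal 0 1 x

/-- upper tail of the standard normal -/
noncomputable def qq (x : ℝ) : ℝ := ∫ t in Ioi x, ph t

lemma ph_eq (x : ℝ) : ph x = (Real.sqrt (2 * Real.pi))⁻¹ * Real.exp (-x ^ 2 / 2) := by
  simp [ph, gaussianPDFReal]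

lemma ph_pos (x : ℝ) : 0 < ph x := gaussianPDFReal_pos 0 1 x one_ne_zero

lemma ph_neg (x : ℝ) : ph (-x) = ph x := by simp [ph_eq]

lemma ph_le_zero (x : ℝ) : ph x ≤ ph 0 := by
  rw [ph_eq, ph_eq]
  have : Real.exp (-x ^ 2 / 2) ≤ Real.exp (-(0 : ℝ) ^ 2 / 2) := by
    apply Real.exp_le_exp.2
    nlinarith [sq_nonneg x]
  gcongr

lemma two_ph_zero : 2 * ph 0 = Real.sqrt (2 / Real.pi) := by
  have hpi := Real.pi_pos
  rw [ph_eq, eq_comm, Real.sqrt_eq_iff_mul_self_eq (by positivity) (by positivity)]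
  have h : Real.sqrt (2 * Real.pi) * Real.sqrt (2 * Real.pi) = 2 * Real.pi :=
    Real.mul_self_sqrt (by positivity)
  have hs : 0 < Real.sqrt (2 * Real.pi) := by positivity
  simp only [ne_eq, OfNat.ofNat_ne_zero, not_false_eq_true, zero_pow, neg_zero, zero_div,
    Real.exp_zero, mul_one]
  field_simp
  nlinarith

lemma ph_zero_le : ph 0 ≤ 1 := by
  have h := two_ph_zero
  have : Real.sqrt (2 / Real.pi) ≤ 1 := by
    rw [Real.sqrt_le_one, div_le_one Real.pi_pos]
    linarith [Real.pi_gt_three]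
  linarith

lemma ph_deriv (x : ℝ) : HasDerivAt ph (-x * ph x) x := by
  have h : HasDerivAt (fun y : ℝ => (Real.sqrt (2 * Real.pi))⁻¹ * Real.exp (-y ^ 2 / 2))
      ((Real.sqrt (2 * Real.pi))⁻¹ * (Real.exp (-x ^ 2 / 2) * (-(2 * x) / 2))) x := by
    apply HasDerivAt.const_mul
    apply HasDerivAt.exp
    apply HasDerivAt.div_const
    exact hd_congr (hasDerivAt_pow 2 x).neg (fun _ => rfl) (by norm_num)
  have e : ph = fun y : ℝ => (Real.sqrt (2 * Real.pi))⁻¹ * Real.exp (-y ^ 2 / 2) := by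
    funext y; exact ph_eq y
  rw [e]
  convert h using 1
  ring

lemma ph_cont : Continuous ph :=
  continuous_iff_continuousAt.2 fun x => (ph_deriv x).continuousAt

lemma ph_int : Integrable ph := integrable_gaussianPDFReal 0 1

lemma ph_int_one : ∫ x, ph x = 1 := integral_gaussianPDFReal_eq_one 0 one_ne_zero

lemma id_ph_int : Integrable (fun x => x * ph x) := by
  have h := (integrable_mul_exp_neg_mul_sq (b := 1 / 2) (by norm_num)).const_mul
    ((Real.sqrt (2 * Real.pi))⁻¹)
  refine h.congr (ae_of_all _ fun x => ?_)
  simp only [ph_eq]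
  rw [show -x ^ 2 / 2 = -(1 / 2) * x ^ 2 by ring]
  ring

lemma ph_tendsto : Tendsto ph atTop (𝓝 0) := by
  have h : Tendsto (fun x : ℝ => -x ^ 2 / 2) atTop atBot := by
    have : Tendsto (fun x : ℝ => x ^ 2) atTop atTop := tendsto_pow_atTop two_ne_zero
    have h2 := (this.atTop_div_const (by norm_num : (0:ℝ) < 2))
    refine (tendsto_neg_atTop_atBot.comp h2).congr fun x => ?_
    simp only [Function.comp]; ring
  have h3 := ((Real.tendsto_exp_atBot.comp h).const_mul ((Real.sqrt (2 * Real.pi))⁻¹))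
  rw [mul_zero] at h3
  exact h3.congr fun x => (ph_eq x).symm

/-- derivative of an upper-tail integral -/
lemma tail_deriv {k : ℝ → ℝ} (hk : Continuous k) (hi : ∀ x, IntegrableOn k (Ioi x)) (x : ℝ) :
    HasDerivAt (fun y => ∫ t in Ioi y, k t) (-k x) x := by
  have e : (fun y => ∫ t in Ioi y, k t) = fun y => (∫ t in Ioi 0, k t) - ∫ t in (0:ℝ)..y, k t := by
    funext y
    rw [← intervalIntegral.integral_Ioi_sub_Ioi' (hi 0) (hi y)]
    ring
  rw [e]
  have := (intervalIntegral.integral_hasDerivAt_right (hk.intervalIntegrable 0 x)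
    (hk.stronglyMeasurableAtFilter _ _) hk.continuousAt)
  simpa using this.const_sub (∫ t in Ioi 0, k t)

lemma qq_deriv (x : ℝ) : HasDerivAt qq (-ph x) x :=
  tail_deriv ph_cont (fun _ => ph_int.integrableOn) x

lemma qq_neg_deriv (x : ℝ) : HasDerivAt (fun y => qq (-y)) (ph x) x := by
  have h := (qq_deriv (-x)).comp x (hasDerivAt_neg x)
  rw [ph_neg] at h
  exact hd_congr h (fun _ => rfl) (by ring)

lemma qq_cont : Continuous qq :=
  continuous_iff_continuousAt.2 fun x => (qq_deriv x).continuousAt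

lemma qq_nonneg (x : ℝ) : 0 ≤ qq x :=
  setIntegral_nonneg measurableSet_Ioi fun t _ => (ph_pos t).le

lemma qq_add (x : ℝ) : qq (-x) + qq x = 1 := by
  have h : qq (-x) = ∫ t in Iic x, ph t := by
    unfold qq
    rw [← integral_comp_neg_Iic]
    simp [ph_neg]
  rw [h, ← ph_int_one]
  unfold qq
  exact intervalIntegral.integral_Iic_add_Ioi ph_int.integrableOn ph_int.integrableOn

lemma id_ph_tail (x : ℝ) : ∫ t in Ioi x, t * ph t = ph x := by
  have h := integral_Ioi_of_hasDerivAt_of_tendsto' (f := fun t => - ph t)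
    (f' := fun t => t * ph t) (a := x) (m := 0)
    (fun t _ => hd_congr (ph_deriv t).neg (fun _ => rfl) (by ring))
    id_ph_int.integrableOn (by simpa using ph_tendsto.neg)
  simpa using h

/-- `E (Z-x)^+` -/
noncomputable def bb (x : ℝ) : ℝ := ph x - x * qq x

lemma bb_nonneg (x : ℝ) : 0 ≤ bb x := by
  have : bb x = ∫ t in Ioi x, (t - x) * ph t := by
    have e : ∀ t, (t - x) * ph t = t * ph t - x * ph t := fun t => by ring
    simp_rw [e]
    rw [integral_sub id_ph_int.integrableOn (ph_int.const_mul x).integrableOn, id_ph_tail,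
      integral_const_mul]
    rfl
  rw [this]
  exact setIntegral_nonneg measurableSet_Ioi fun t ht =>
    mul_nonneg (sub_nonneg.2 (le_of_lt ht)) (ph_pos t).le

lemma bb_deriv (x : ℝ) : HasDerivAt bb (-qq x) x := by
  have h := (ph_deriv x).sub ((hasDerivAt_id x).mul (qq_deriv x))
  refine hd_congr h (fun _ => rfl) ?_
  simp only [id]; ring

lemma bb_le (x : ℝ) (hx : 0 ≤ x) : bb x ≤ ph x := by
  have := mul_nonneg hx (qq_nonneg x)
  unfold bb; linarith

lemma bb_tendsto : Tendsto bb atTop (𝓝 0) := by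
  refine tendsto_of_tendsto_of_tendsto_of_le_of_le' tendsto_const_nhds ph_tendsto ?_ ?_
  · exact Eventually.of_forall bb_nonneg
  · filter_upwards [eventually_ge_atTop 0] with x hx using bb_le x hx

lemma qq_tendsto : Tendsto qq atTop (𝓝 0) := by
  refine tendsto_of_tendsto_of_tendsto_of_le_of_le' tendsto_const_nhds ph_tendsto ?_ ?_
  · exact Eventually.of_forall qq_nonneg
  · filter_upwards [eventually_ge_atTop 1] with x hx
    have h1 := bb_nonneg x
    have h2 := qq_nonneg x
    unfold bb at h1
    nlinarith

lemma mills_aux (x : ℝ) : 0 ≤ qq x - x * ph x / (1 + x ^ 2) := by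
  have hd : ∀ x : ℝ, HasDerivAt (fun x => qq x - x * ph x / (1 + x ^ 2))
      (-(2 * ph x / (1 + x ^ 2) ^ 2)) x := by
    intro x
    have hne : (1 + x ^ 2) ≠ 0 := by positivity
    have h1 : HasDerivAt (fun x : ℝ => 1 + x ^ 2) (2 * x) x := by
      simpa using (hasDerivAt_pow 2 x).const_add 1
    have h := (qq_deriv x).sub ((((hasDerivAt_id x).mul (ph_deriv x))).div h1 hne)
    refine hd_congr h (fun _ => rfl) ?_
    simp only [id, Pi.mul_apply]
    field_simp
    ring
  have hanti := antitone_of_hasDerivAt_nonpos hd (fun x => by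
    have := ph_pos x
    exact neg_nonpos.2 (by positivity))
  have ht : Tendsto (fun x => qq x - x * ph x / (1 + x ^ 2)) atTop (𝓝 0) := by
    have h2 : Tendsto (fun x => x * ph x / (1 + x ^ 2)) atTop (𝓝 0) := by
      refine tendsto_of_tendsto_of_tendsto_of_le_of_le' tendsto_const_nhds ph_tendsto ?_ ?_
      · filter_upwards [eventually_ge_atTop 0] with x hx
        have := ph_pos x
        positivity
      · filter_upwards [eventually_ge_atTop 0] with x hx
        have := ph_pos x
        rw [div_le_iff₀ (by positivity)]
        nlinarith [sq_nonneg (x - 1)]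
    simpa using qq_tendsto.sub h2
  exact hanti.le_of_tendsto ht x

lemma mills (x : ℝ) : 0 ≤ (1 + x ^ 2) * qq x - x * ph x := by
  have h := mills_aux x
  have hp : 0 < 1 + x ^ 2 := by positivity
  have := mul_nonneg hp.le h
  rw [mul_sub, mul_div_cancel₀ _ hp.ne'] at this
  exact this

/-! The function `g = a b / φ`, and its derivatives, in terms of `φ`, `d = Φ - (1-Φ)`,
`R = Φ (1 - Φ) / φ`. -/

noncomputable def dd (x : ℝ) : ℝ := qq (-x) - qq x
noncomputable def rr (x : ℝ) : ℝ := qq (-x) * qq x / ph x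

lemma dd_deriv (x : ℝ) : HasDerivAt dd (2 * ph x) x := by
  have h := (qq_neg_deriv x).sub (qq_deriv x)
  refine hd_congr h (fun _ => rfl) ?_
  ring

lemma rr_deriv (x : ℝ) : HasDerivAt rr (-dd x + x * rr x) x := by
  have hp := (ph_pos x).ne'
  have h := ((qq_neg_deriv x).mul (qq_deriv x)).div (ph_deriv x) hp
  refine hd_congr h (fun _ => rfl) ?_
  simp only [dd, rr, Pi.mul_apply]
  field_simp
  ring

noncomputable def g0 (x : ℝ) : ℝ := ph x + x * dd x - x ^ 2 * rr x
noncomputable def g1 (x : ℝ) : ℝ := x * ph x + (1 + x ^ 2) * dd x - (2 * x + x ^ 3) * rr x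
noncomputable def g2 (x : ℝ) : ℝ :=
  (3 + x ^ 2) * ph x + (4 * x + x ^ 3) * dd x - (2 + 5 * x ^ 2 + x ^ 4) * rr x

lemma comb_deriv {u v w : ℝ → ℝ} {u' v' w' x : ℝ} (hu : HasDerivAt u u' x)
    (hv : HasDerivAt v v' x) (hw : HasDerivAt w w' x) :
    HasDerivAt (fun x => u x * ph x + v x * dd x - w x * rr x)
      (u' * ph x + u x * (-x * ph x) + (v' * dd x + v x * (2 * ph x))
        - (w' * rr x + w x * (-dd x + x * rr x))) x :=
  ((hu.mul (ph_deriv x)).add (hv.mul (dd_deriv x))).sub (hw.mul (rr_deriv x))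

lemma poly_deriv (c0 c1 c2 c3 c4 x : ℝ) :
    HasDerivAt (fun x : ℝ => c0 + c1 * x + c2 * x ^ 2 + c3 * x ^ 3 + c4 * x ^ 4)
      (c1 + c2 * (2 * x) + c3 * (3 * x ^ 2) + c4 * (4 * x ^ 3)) x := by
  have h1 := (hasDerivAt_id x).const_mul c1
  have h2 := (hasDerivAt_pow 2 x).const_mul c2
  have h3 := (hasDerivAt_pow 3 x).const_mul c3
  have h4 := (hasDerivAt_pow 4 x).const_mul c4
  have h := (((h1.const_add c0).add h2).add h3).add h4
  refine hd_congr h (fun _ => rfl) ?_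
  norm_num

lemma g0_deriv (x : ℝ) : HasDerivAt g0 (g1 x) x := by
  have h := comb_deriv (poly_deriv 1 0 0 0 0 x) (poly_deriv 0 1 0 0 0 x) (poly_deriv 0 0 1 0 0 x)
  refine hd_congr h (fun y => ?_) ?_
  · simp only [g0]; ring
  · simp only [g1]; ring

lemma g1_deriv (x : ℝ) : HasDerivAt g1 (g2 x) x := by
  have h := comb_deriv (poly_deriv 0 1 0 0 0 x) (poly_deriv 1 0 1 0 0 x) (poly_deriv 0 2 0 1 0 x)
  refine hd_congr h (fun y => ?_) ?_
  · simp only [g1]; ring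
  · simp only [g2]; ring

lemma g2_deriv (x : ℝ) : HasDerivAt g2 ((x ^ 2 + 6) * g1 x + x * g0 x) x := by
  have h := comb_deriv (poly_deriv 3 0 1 0 0 x) (poly_deriv 0 4 0 1 0 x) (poly_deriv 2 0 5 0 1 x)
  refine hd_congr h (fun y => ?_) ?_
  · simp only [g2]; ring
  · simp only [g1, g0]; ring

lemma bb_neg (x : ℝ) : bb (-x) = ph x + x * qq (-x) := by
  simp [bb, ph_neg]

lemma g0_eq (x : ℝ) : g0 x = bb (-x) * bb x / ph x := by
  have hp := (ph_pos x).ne'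
  rw [bb_neg]
  simp only [g0, dd, rr, bb]
  field_simp
  ring

lemma g0_nonneg (x : ℝ) : 0 ≤ g0 x := by
  rw [g0_eq]
  exact div_nonneg (mul_nonneg (bb_nonneg _) (bb_nonneg _)) (ph_pos x).le

lemma g1_eq (x : ℝ) : g1 x = (2 * qq (-x) + x * bb (-x)) * (bb x / ph x) - 1 := by
  have hp := (ph_pos x).ne'
  have h := qq_add x
  have hq : qq x = 1 - qq (-x) := by linarith
  rw [bb_neg]
  simp only [g1, dd, rr, bb]
  rw [hq]
  field_simp
  ring

lemma g1_bound (x : ℝ) (hx : 0 ≤ x) : g1 x ≤ (1 + x) / (1 + x ^ 2) := by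
  have hp := ph_pos x
  have h := qq_add x
  have hq := qq_nonneg x
  have hq' := qq_nonneg (-x)
  have h1 : bb x / ph x ≤ 1 / (1 + x ^ 2) := by
    rw [div_le_div_iff₀ hp (by positivity)]
    have := mills x
    unfold bb
    nlinarith
  have h2 : bb (-x) ≤ x + 1 := by
    have e : bb (-x) = x + bb x := by
      rw [bb_neg]; unfold bb; linear_combination x * h
    have := bb_le x hx
    have := ph_le_zero x
    have := ph_zero_le
    linarith
  have h3 : 2 * qq (-x) + x * bb (-x) ≤ 2 + x * (x + 1) := by
    have := mul_le_mul_of_nonneg_left h2 hx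
    linarith
  have h4 : 0 ≤ bb x / ph x := div_nonneg (bb_nonneg _) hp.le
  rw [g1_eq]
  have h5 := mul_le_mul h3 h1 h4 (by positivity)
  have h6 : (2 + x * (x + 1)) * (1 / (1 + x ^ 2)) - 1 = (1 + x) / (1 + x ^ 2) := by
    field_simp
    ring
  linarith

lemma g1_nonpos (x : ℝ) (hx : 0 ≤ x) : g1 x ≤ 0 := by
  by_contra! hpos
  have h0 : g1 0 = 0 := by simp [g1, dd]
  set ε := g1 x with hε
  set T := max (max 1 (2 / ε + 1)) x with hT
  have hT1 : 1 ≤ T := le_trans (le_max_left _ _) (le_max_left _ _)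
  have hT2 : 2 / ε < T := by
    have : 2 / ε + 1 ≤ T := le_trans (le_max_right _ _) (le_max_left _ _)
    linarith
  have hT3 : x ≤ T := le_max_right _ _
  have hTlt : g1 T < ε := by
    refine (g1_bound T (by linarith)).trans_lt ?_
    rw [div_lt_iff₀ hpos] at hT2
    rw [div_lt_iff₀ (by positivity)]
    nlinarith
  have hc : Continuous g1 := continuous_iff_continuousAt.2 fun y => (g1_deriv y).continuousAt
  obtain ⟨y, hy, hmax⟩ := isCompact_Icc.exists_isMaxOn (⟨x, hx, hT3⟩ : (Icc 0 T).Nonempty)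
    hc.continuousOn
  have hxy : ε ≤ g1 y := hmax ⟨hx, hT3⟩
  have hy0 : 0 < y := by
    rcases hy.1.eq_or_lt with h | h
    · rw [← h, h0] at hxy; linarith
    · exact h
  have hyT : y < T := by
    rcases hy.2.eq_or_lt with h | h
    · rw [h] at hxy; linarith
    · exact h
  have hlm : IsLocalMax g1 y := hmax.isLocalMax (Icc_mem_nhds hy0 hyT)
  have hd1 : deriv g1 = g2 := funext fun z => (g1_deriv z).deriv
  have hd2 : deriv (deriv g1) y = (y ^ 2 + 6) * g1 y + y * g0 y := by
    rw [hd1]; exact (g2_deriv y).deriv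
  have hp : 0 < deriv (deriv g1) y := by
    rw [hd2]
    have := g0_nonneg y
    have : 0 < g1 y := hpos.trans_le hxy
    positivity
  have hmin := isLocalMin_of_deriv_deriv_pos hp hlm.deriv_eq_zero hc.continuousAt
  have heq : g1 =ᶠ[𝓝 y] fun _ => g1 y := by
    filter_upwards [hlm, hmin] with z h1 h2 using le_antisymm h1 h2
  have h2 := heq.deriv.deriv_eq
  simp at h2
  rw [h2] at hp
  exact lt_irrefl _ hp

lemma g0_le_of_nonneg (x : ℝ) (hx : 0 ≤ x) : g0 x ≤ ph 0 := by
  have hc : Continuous g0 := continuous_iff_continuousAt.2 fun y => (g0_deriv y).continuousAt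
  have h := antitoneOn_of_hasDerivWithinAt_nonpos (convex_Ici 0) hc.continuousOn
    (fun y _ => (g0_deriv y).hasDerivWithinAt) (fun y hy => g1_nonpos y (interior_subset hy))
  have h2 := h (self_mem_Ici) hx hx
  simpa [g0] using h2

lemma g0_le (x : ℝ) : g0 x ≤ ph 0 := by
  rcases le_total 0 x with hx | hx
  · exact g0_le_of_nonneg x hx
  · have h := g0_le_of_nonneg (-x) (by linarith)
    rw [g0_eq] at h ⊢
    rw [ph_neg, neg_neg] at h
    rwa [mul_comm]

lemma qq_intOn (x : ℝ) : IntegrableOn qq (Ioi x) := by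
  have h := integrableOn_Ioi_deriv_of_nonpos' (a := x) (fun y _ => bb_deriv y)
    (fun y _ => neg_nonpos.2 (qq_nonneg y)) bb_tendsto
  exact integrable_neg_iff.1 h

lemma qq_integral (x : ℝ) : ∫ t in Ioi x, qq t = bb x := by
  have h := integral_Ioi_of_hasDerivAt_of_nonpos' (a := x) (fun y _ => bb_deriv y)
    (fun y _ => neg_nonpos.2 (qq_nonneg y)) bb_tendsto
  rw [integral_neg] at h
  linarith

noncomputable def BB (k : ℝ → ℝ) (x : ℝ) : ℝ := ∫ t in Ioi x, k t * qq t

noncomputable def AA (k : ℝ → ℝ) (x : ℝ) : ℝ := BB (fun t => k (-t)) (-x)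

lemma kq_intOn {k : ℝ → ℝ} (hk : Continuous k) (hb : ∀ x, |k x| ≤ 1) (x : ℝ) :
    IntegrableOn (fun t => k t * qq t) (Ioi x) := by
  refine Integrable.mono' (qq_intOn x) (hk.mul qq_cont).aestronglyMeasurable
    (ae_of_all _ fun t => ?_)
  rw [Real.norm_eq_abs, abs_mul, abs_of_nonneg (qq_nonneg t)]
  exact mul_le_of_le_one_left (qq_nonneg t) (hb t)

lemma BB_bound {k : ℝ → ℝ} (hb : ∀ x, |k x| ≤ 1) (x : ℝ) :
    |BB k x| ≤ bb x := by
  rw [← qq_integral, ← Real.norm_eq_abs]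
  refine norm_integral_le_of_norm_le (qq_intOn x) (ae_of_all _ fun t => ?_)
  rw [Real.norm_eq_abs, abs_mul, abs_of_nonneg (qq_nonneg t)]
  exact mul_le_of_le_one_left (qq_nonneg t) (hb t)

lemma BB_deriv {k : ℝ → ℝ} (hk : Continuous k) (hb : ∀ x, |k x| ≤ 1) (x : ℝ) :
    HasDerivAt (BB k) (-(k x * qq x)) x :=
  tail_deriv (hk.mul qq_cont) (kq_intOn hk hb) x

lemma AA_bound {k : ℝ → ℝ} (hb : ∀ x, |k x| ≤ 1) (x : ℝ) :
    |AA k x| ≤ bb (-x) := BB_bound (fun t => hb (-t)) (-x)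

lemma AA_deriv {k : ℝ → ℝ} (hk : Continuous k) (hb : ∀ x, |k x| ≤ 1) (x : ℝ) :
    HasDerivAt (AA k) (k x * qq (-x)) x := by
  have h := (BB_deriv (k := fun t => k (-t)) (hk.comp continuous_neg) (fun t => hb (-t)) (-x)).comp x
    (hasDerivAt_neg x)
  refine hd_congr h (fun _ => rfl) ?_
  simp

/-- solution of Stein's equation -/
noncomputable def ff (k : ℝ → ℝ) (x : ℝ) : ℝ := -(qq x * AA k x + qq (-x) * BB k x) / ph x

noncomputable def ff1 (k : ℝ → ℝ) (x : ℝ) : ℝ := (bb x * AA k x - bb (-x) * BB k x) / ph x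

noncomputable def ff2 (k : ℝ → ℝ) (x : ℝ) : ℝ :=
  k x - (((1 + x ^ 2) * qq x - x * ph x) * AA k x
    + ((1 + x ^ 2) * qq (-x) + x * ph x) * BB k x) / ph x

section
variable {k : ℝ → ℝ} (hk : Continuous k) (hb : ∀ x, |k x| ≤ 1)

lemma ff_deriv (hk : Continuous k) (hb : ∀ x, |k x| ≤ 1) (x : ℝ) :
    HasDerivAt (ff k) (ff1 k x) x := by
  have hp := (ph_pos x).ne'
  have h := (((qq_deriv x).mul (AA_deriv hk hb x)).add
    ((qq_neg_deriv x).mul (BB_deriv hk hb x))).neg.div (ph_deriv x) hp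
  refine hd_congr h (fun _ => rfl) ?_
  simp only [ff1, bb_neg, Pi.mul_apply, Pi.add_apply, Pi.neg_apply]
  simp only [bb]
  field_simp
  ring

lemma bb_neg_deriv (x : ℝ) : HasDerivAt (fun y => bb (-y)) (qq (-x)) x := by
  have h := (bb_deriv (-x)).comp x (hasDerivAt_neg x)
  exact hd_congr h (fun _ => rfl) (by ring)

lemma ff1_deriv (hk : Continuous k) (hb : ∀ x, |k x| ≤ 1) (x : ℝ) :
    HasDerivAt (ff1 k) (ff2 k x) x := by
  have hp := (ph_pos x).ne'
  have h := (((bb_deriv x).mul (AA_deriv hk hb x)).sub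
    ((bb_neg_deriv x).mul (BB_deriv hk hb x))).div (ph_deriv x) hp
  refine hd_congr h (fun _ => rfl) ?_
  simp only [ff2, bb_neg, Pi.mul_apply, Pi.sub_apply]
  simp only [bb]
  have hq : qq (-x) = 1 - qq x := by linarith [qq_add x]
  rw [hq]
  field_simp
  ring

lemma abs_comb {u v A B a b : ℝ} (hu : 0 ≤ u) (hv : 0 ≤ v) (hA : |A| ≤ a) (hB : |B| ≤ b) :
    |u * A + v * B| ≤ u * a + v * b := by
  refine (abs_add_le _ _).trans ?_
  rw [abs_mul, abs_mul, abs_of_nonneg hu, abs_of_nonneg hv]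
  gcongr

lemma ff_bound (hb : ∀ x, |k x| ≤ 1) (x : ℝ) : |ff k x| ≤ 1 := by
  have hp := ph_pos x
  have h := abs_comb (qq_nonneg x) (qq_nonneg (-x)) (AA_bound hb x) (BB_bound hb x)
  unfold ff
  rw [abs_div, abs_neg, abs_of_pos hp, div_le_one hp]
  refine h.trans (le_of_eq ?_)
  rw [bb_neg, bb]
  linear_combination ph x * qq_add x

lemma ff1_bound (hb : ∀ x, |k x| ≤ 1) (x : ℝ) : |ff1 k x| ≤ Real.sqrt (2 / Real.pi) := by
  have hp := ph_pos x
  have hB : |-BB k x| ≤ bb x := by rw [abs_neg]; exact BB_bound hb x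
  have h := abs_comb (bb_nonneg x) (bb_nonneg (-x)) (AA_bound hb x) hB
  have hg := g0_le x
  rw [g0_eq, div_le_iff₀ hp] at hg
  rw [← two_ph_zero]
  unfold ff1
  rw [abs_div, abs_of_pos hp, div_le_iff₀ hp]
  rw [sub_eq_add_neg, ← mul_neg]
  linarith

lemma ff2_bound (hb : ∀ x, |k x| ≤ 1) (x : ℝ) : |ff2 k x| ≤ 2 := by
  have hp := ph_pos x
  have hm : 0 ≤ (1 + x ^ 2) * qq (-x) + x * ph x := by
    have := mills (-x)
    rw [ph_neg] at this
    linarith [this, neg_sq x ▸ this]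
  have h := abs_comb (mills x) hm (AA_bound hb x) (BB_bound hb x)
  unfold ff2
  refine (abs_sub _ _).trans ?_
  have : |(((1 + x ^ 2) * qq x - x * ph x) * AA k x
    + ((1 + x ^ 2) * qq (-x) + x * ph x) * BB k x) / ph x| ≤ 1 := by
    rw [abs_div, abs_of_pos hp, div_le_one hp]
    refine h.trans (le_of_eq ?_)
    rw [bb_neg, bb]
    linear_combination ph x * qq_add x
  linarith [hb x]

lemma ff_cont (hk : Continuous k) (hb : ∀ x, |k x| ≤ 1) : Continuous (ff k) :=
  continuous_iff_continuousAt.2 fun x => (ff_deriv hk hb x).continuousAt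

lemma ff1_cont (hk : Continuous k) (hb : ∀ x, |k x| ≤ 1) : Continuous (ff1 k) :=
  continuous_iff_continuousAt.2 fun x => (ff1_deriv hk hb x).continuousAt

lemma stein_eq (hk : Continuous k) (hb : ∀ x, |k x| ≤ 1) {h : ℝ → ℝ}
    (hh : ∀ x, HasDerivAt h (k x) x) : ∃ c, ∀ x, h x = ff1 k x - x * ff k x + c := by
  have hd : ∀ x, HasDerivAt (fun x => h x - (AA k x - BB k x)) 0 x := by
    intro x
    have h1 := (hh x).sub ((AA_deriv hk hb x).sub (BB_deriv hk hb x))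
    refine hd_congr h1 (fun _ => rfl) ?_
    linear_combination k x * qq_add x
  have hconst := is_const_of_deriv_eq_zero (fun x => (hd x).differentiableAt)
    (fun x => (hd x).deriv)
  refine ⟨h 0 - (AA k 0 - BB k 0), fun x => ?_⟩
  have h1 := hconst x 0
  have hp := (ph_pos x).ne'
  have h2 : ff1 k x - x * ff k x = AA k x - BB k x := by
    unfold ff1 ff
    rw [bb_neg, bb]
    field_simp
    ring
  rw [h2, ← h1]; ring

lemma gauss_stein (hk : Continuous k) (hb : ∀ x, |k x| ≤ 1) :
    ∫ z, (ff1 k z - z * ff k z) ∂(gaussianReal 0 1) = 0 := by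
  rw [integral_gaussianReal_eq_integral_smul one_ne_zero]
  have hd : ∀ x, HasDerivAt (fun x => ff k x * ph x)
      (gaussianPDFReal 0 1 x • (ff1 k x - x * ff k x)) x := by
    intro x
    refine hd_congr ((ff_deriv hk hb x).mul (ph_deriv x)) (fun _ => rfl) ?_
    change ph x * _ = _
    ring
  have hi : Integrable (fun x => gaussianPDFReal 0 1 x • (ff1 k x - x * ff k x)) := by
    have h1 : Integrable (fun x => ff1 k x * ph x) :=
      ph_int.bdd_mul (ff1_cont hk hb).aestronglyMeasurable (ae_of_all _ (ff1_bound hb))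
    have h2 : Integrable (fun x => ff k x * (x * ph x)) :=
      id_ph_int.bdd_mul (ff_cont hk hb).aestronglyMeasurable (ae_of_all _ (ff_bound hb))
    refine (h1.sub h2).congr (ae_of_all _ fun x => ?_)
    change ff1 k x * ph x - ff k x * (x * ph x) = ph x * _
    ring
  have hbd : ∀ x, |ff k x * ph x| ≤ ph x := fun x => by
    rw [abs_mul, abs_of_pos (ph_pos x)]
    exact mul_le_of_le_one_left (ph_pos x).le (ff_bound hb x)
  have hbot : Tendsto ph atBot (𝓝 0) :=
    (ph_tendsto.comp tendsto_neg_atBot_atTop).congr fun x => ph_neg x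
  have := integral_of_hasDerivAt_of_tendsto hd hi
    (squeeze_zero_norm hbd hbot) (squeeze_zero_norm hbd ph_tendsto)
  simpa using this

lemma int_parts (hk : Continuous k) (hb : ∀ x, |k x| ≤ 1) {Ω : Type*} [MeasurableSpace Ω]
    (P : Measure Ω) [IsProbabilityMeasure P]
    (X : Ω → ℝ) (hXm : Measurable X) (hXi : Integrable X P) :
    Integrable (fun ω => ff1 k (X ω)) P ∧ Integrable (fun ω => X ω * ff k (X ω)) P := by
  constructor
  · exact Integrable.of_bound ((ff1_cont hk hb).measurable.comp hXm).aestronglyMeasurable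
      _ (ae_of_all _ fun ω => ff1_bound hb (X ω))
  · exact hXi.mul_bdd ((ff_cont hk hb).measurable.comp hXm).aestronglyMeasurable
      (ae_of_all _ fun ω => ff_bound hb (X ω))

end

lemma gauss_id_int : Integrable (fun z : ℝ => z) (gaussianReal 0 1) :=
  by
  have h := memLp_id_gaussianReal (μ := 0) (v := 1) 1
  rw [ENNReal.coe_one, memLp_one_iff_integrable] at h
  exact h

lemma smooth_case {Ω : Type*} [MeasurableSpace Ω] (P : Measure Ω) [IsProbabilityMeasure P]
    (X : Ω → ℝ) (hXm : Measurable X) (hXi : Integrable X P)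
    (C : ℝ)
    (hstein : ∀ f : ℝ → ℝ, Differentiable ℝ f → Differentiable ℝ (deriv f) →
      (∀ x, |f x| ≤ 2) → (∀ x, |deriv f x| ≤ Real.sqrt (2 / Real.pi)) →
      (∀ x, |deriv (deriv f) x| ≤ 2) →
      |(∫ ω, deriv f (X ω) ∂P) - ∫ ω, X ω * f (X ω) ∂P| ≤ C)
    {h k : ℝ → ℝ} (hk : Continuous k) (hb : ∀ x, |k x| ≤ 1) (hh : ∀ x, HasDerivAt h (k x) x) :
    |(∫ ω, h (X ω) ∂P) - ∫ z, h z ∂(gaussianReal 0 1)| ≤ C := by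
  have hd1 : deriv (ff k) = ff1 k := funext fun x => (ff_deriv hk hb x).deriv
  have hd2 : deriv (ff1 k) = ff2 k := funext fun x => (ff1_deriv hk hb x).deriv
  have hs := hstein (ff k) (fun x => (ff_deriv hk hb x).differentiableAt)
    (by rw [hd1]; exact fun x => (ff1_deriv hk hb x).differentiableAt)
    (fun x => (ff_bound hb x).trans (by norm_num))
    (by rw [hd1]; exact ff1_bound hb)
    (by rw [hd1, hd2]; exact ff2_bound hb)
  rw [hd1] at hs
  obtain ⟨c, hc⟩ := stein_eq hk hb hh
  obtain ⟨i1, i2⟩ := int_parts hk hb P X hXm hXi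
  obtain ⟨j1, j2⟩ := int_parts hk hb (gaussianReal 0 1) (fun z => z) measurable_id gauss_id_int
  have e1 : ∫ ω, h (X ω) ∂P = (∫ ω, ff1 k (X ω) ∂P) - (∫ ω, X ω * ff k (X ω) ∂P) + c := by
    simp_rw [hc]
    have i3 : Integrable (fun ω => ff1 k (X ω) - X ω * ff k (X ω)) P := i1.sub i2
    rw [integral_add i3 (integrable_const c), integral_sub i1 i2]
    simp
  have e2 : ∫ z, h z ∂(gaussianReal 0 1) = c := by
    simp_rw [hc]
    have j3 : Integrable (fun z => ff1 k z - z * ff k z) (gaussianReal 0 1) := j1.sub j2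
    rw [integral_add j3 (integrable_const c), gauss_stein hk hb]
    simp
  rw [e1, e2]
  simpa using hs

lemma close_int {Ω : Type*} [MeasurableSpace Ω] (P : Measure Ω) [IsProbabilityMeasure P]
    (X : Ω → ℝ) (hXm : Measurable X) (hXi : Integrable X P) {h g : ℝ → ℝ}
    (hL : LipschitzWith 1 h) (hg : Continuous g) {ε : ℝ} (hc : ∀ x, |g x - h x| ≤ ε) :
    |(∫ ω, g (X ω) ∂P) - ∫ ω, h (X ω) ∂P| ≤ ε := by
  have i0 : Integrable (fun ω => |h 0| + |X ω|) P := (integrable_const _).add hXi.abs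
  have i1 : Integrable (fun ω => h (X ω)) P := by
    refine i0.mono' (hL.continuous.measurable.comp hXm).aestronglyMeasurable
      (ae_of_all _ fun ω => ?_)
    have h1 := hL.dist_le_mul (X ω) 0
    simp only [NNReal.coe_one, one_mul, Real.dist_eq, sub_zero] at h1
    have h2 := abs_sub_abs_le_abs_sub (h (X ω)) (h 0)
    rw [Real.norm_eq_abs]
    linarith
  have i2 : Integrable (fun ω => g (X ω) - h (X ω)) P :=
    Integrable.of_bound ((hg.sub hL.continuous).measurable.comp hXm).aestronglyMeasurable
      ε (ae_of_all _ fun ω => hc (X ω))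
  have i3 : Integrable (fun ω => g (X ω)) P :=
    (i2.add i1).congr (ae_of_all _ fun ω => by simp)
  rw [← integral_sub i3 i1]
  have := norm_integral_le_of_norm_le_const (μ := P) (f := fun ω => g (X ω) - h (X ω))
    (C := ε) (ae_of_all _ fun ω => hc (X ω))
  simpa using this

end SteinAux

open SteinAux in
/-- univariate Stein bound. If `|E[f'(X)] − E[X f(X)]| ≤ C` for every
twice differentiable `f` with `‖f‖_∞ ≤ 2`, `‖f'‖_∞ ≤ √(2/π)`, `‖f''‖_∞ ≤ 2`, then
`|E[h(X)] − ∫ h dγ| ≤ C` for every 1-Lipschitz `h`, i.e. `d_Wass(X, N(0,1)) ≤ C`. -/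
theorem stmt5 {Ω : Type*} [MeasurableSpace Ω] (P : Measure Ω) [IsProbabilityMeasure P]
    (X : Ω → ℝ) (hXm : Measurable X) (hXi : Integrable X P)
    (C : ℝ) (hC : 0 ≤ C)
    (hstein : ∀ f : ℝ → ℝ, Differentiable ℝ f → Differentiable ℝ (deriv f) →
      (∀ x, |f x| ≤ 2) → (∀ x, |deriv f x| ≤ Real.sqrt (2 / Real.pi)) →
      (∀ x, |deriv (deriv f) x| ≤ 2) →
      |(∫ ω, deriv f (X ω) ∂P) - ∫ ω, X ω * f (X ω) ∂P| ≤ C) :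
    ∀ h : ℝ → ℝ, LipschitzWith 1 h →
      |(∫ ω, h (X ω) ∂P) - ∫ z, h z ∂(gaussianReal 0 1)| ≤ C := by
  intro h hL
  have hcont := hL.continuous
  have key : ∀ ε : ℝ, 0 < ε →
      |(∫ ω, h (X ω) ∂P) - ∫ z, h z ∂(gaussianReal 0 1)| ≤ C + 2 * ε := by
    intro ε hε
    have hlip : ∀ x y, |h x - h y| ≤ |x - y| := fun x y => by
      have h1 := hL.dist_le_mul x y
      simpa [Real.dist_eq] using h1
    set H : ℝ → ℝ := fun y => ∫ t in (0:ℝ)..y, h t with hH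
    have hHd : ∀ y, HasDerivAt H (h y) y := fun y =>
      intervalIntegral.integral_hasDerivAt_right (hcont.intervalIntegrable 0 y)
        (hcont.stronglyMeasurableAtFilter _ _) hcont.continuousAt
    have hHc : Continuous H := continuous_iff_continuousAt.2 fun y => (hHd y).continuousAt
    set g : ℝ → ℝ := fun x => (H (x + ε) - H x) / ε with hg
    set k : ℝ → ℝ := fun x => (h (x + ε) - h x) / ε with hk
    have hkc : Continuous k := by fun_prop
    have hgd : ∀ x, HasDerivAt g (k x) x := fun x => by
      have h1 := (hHd (x + ε)).comp_add_const x ε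
      exact hd_congr ((h1.sub (hHd x)).div_const ε) (fun _ => rfl) rfl
    have hkb : ∀ x, |k x| ≤ 1 := fun x => by
      have h1 := hlip (x + ε) x
      rw [add_sub_cancel_left, abs_of_pos hε] at h1
      rw [hk]
      simp only
      rwa [abs_div, abs_of_pos hε, div_le_one hε]
    have hgh : ∀ x, |g x - h x| ≤ ε := fun x => by
      obtain ⟨c, hc, he⟩ := exists_hasDerivAt_eq_slope H h (by linarith : x < x + ε)
        hHc.continuousOn (fun y _ => hHd y)
      rw [add_sub_cancel_left] at he
      have h1 := hlip c x
      rw [abs_of_pos (sub_pos.2 hc.1), he] at h1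
      have h2 := hc.2
      exact h1.trans (by linarith)
    have hgc : Continuous g := continuous_iff_continuousAt.2 fun y => (hgd y).continuousAt
    have a1 := abs_le.1 (smooth_case P X hXm hXi C hstein hkc hkb hgd)
    have a2 := abs_le.1 (close_int P X hXm hXi hL hgc hgh)
    have a3 := abs_le.1 (close_int (gaussianReal 0 1) (fun z => z) measurable_id gauss_id_int
      hL hgc hgh)
    exact abs_le.2 ⟨by linarith [a1.1, a2.2, a3.1], by linarith [a1.2, a2.1, a3.2]⟩
  refine le_of_forall_pos_le_add fun ε hε => ?_
  have := key (ε / 2) (by linarith)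
  linarith
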